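/- Let p ≥ 5 be prime, d = (p-1)/2, ζ a primitive p-th root of unity, O = ℤ[ζ], h = 1-ζ, A = -ζ^{d+1}. Let 0 ≤ c ≤ d-1 and 0 ≤ m ≤ n ≤ d-c-1, and define b^{(c)}_{n,m} = ∑_{l=0}^{m+c} C^{l}_{l+n-m, m+c} · ( γ_{l+n-m} / {l+n-m}! ) · ( {n}! / {m}! ) as an element of ℚ(ζ). Then b^{(c)}_{n,m} lies in O and 2^{n-m}·b^{(c)}_{n,m} - (-1)^{n-m}·C(n,m) ∈ (1-ζ)·O, where C(n,m) is the ordinary binomial coefficient. -/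

import Mathlib

open Finset

/-- Quantum integer `{k} = (-A)^k - (-A)^(-k)`. -/
noncomputable def qint {F : Type*} [Field F] (A : F) (k : ℤ) : F :=
  (-A) ^ k - (-A) ^ (-k)

/-- Quantum factorial `{n}! = {1}{2}⋯{n}`, with `{0}! = 1`. -/
noncomputable def qfact {F : Type*} [Field F] (A : F) (n : ℕ) : F :=
  ∏ k ∈ Finset.range n, qint A ((k : ℤ) + 1)

/-- `C^l_{m,n} = (-1)^l {m}!{n}!{m+n+1}! / ({m-l}!{n-l}!{m+n+1-l}!{l}!)`. -/
noncomputable def Ccoef {F : Type*} [Field F] (A : F) (l m n : ℕ) : F :=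
  (-1) ^ l * (qfact A m * qfact A n * qfact A (m + n + 1)) /
    (qfact A (m - l) * qfact A (n - l) * qfact A (m + n + 1 - l) * qfact A l)

/-- `γ_m = (-A)^((m²+5m)/2) / ∏_{k=1}^{m}(A^(2k+1)-1)`. -/
noncomputable def gammaCoef {F : Type*} [Field F] (A : F) (m : ℕ) : F :=
  (-A) ^ ((m ^ 2 + 5 * m) / 2) / ∏ k ∈ Finset.Icc 1 m, (A ^ (2 * k + 1) - 1)

/-- The matrix coefficient `b^{(c)}_{n,m} = ∑_{l=0}^{m+c} C^l_{l+n-m, m+c}·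
(γ_{l+n-m}/{l+n-m}!)·({n}!/{m}!)` of the twist map `t*` (Theorem 4.8). -/
noncomputable def bCoef {F : Type*} [Field F] (A : F) (c n m : ℕ) : F :=
  ∑ l ∈ Finset.range (m + c + 1),
    Ccoef A l (l + n - m) (m + c) * (gammaCoef A (l + n - m) / qfact A (l + n - m)) *
      (qfact A n / qfact A m)

/-- The ring of cyclotomic integers `O = ℤ[ζ]`, as a subring of `ℂ`. -/
noncomputable def Oring (ζ : ℂ) : Subring ℂ := Subring.closure {ζ}

/-- Pairs `(x, k)` such that `x ≡ k` modulo `h • O`. -/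
def congruenceSubring {R : Type*} [CommRing R] (O : Subring R) (h : R) (hh : h ∈ O) :
    Subring (R × ℤ) where
  carrier := {x | ∃ y ∈ O, x.1 - (x.2 : R) = h * y}
  zero_mem' := ⟨0, zero_mem _, by simp⟩
  one_mem' := ⟨0, zero_mem _, by simp⟩
  add_mem' := by
    rintro ⟨x, k⟩ ⟨x', k'⟩ ⟨y, hy, e⟩ ⟨y', hy', e'⟩
    refine ⟨y + y', add_mem hy hy', ?_⟩
    simp only [Prod.mk_add_mk, Int.cast_add] at e e' ⊢
    linear_combination e + e'
  neg_mem' := by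
    rintro ⟨x, k⟩ ⟨y, hy, e⟩
    refine ⟨-y, neg_mem hy, ?_⟩
    simp only [Prod.neg_mk, Int.cast_neg] at e ⊢
    linear_combination -e
  mul_mem' := by
    rintro ⟨x, k⟩ ⟨x', k'⟩ ⟨y, hy, e⟩ ⟨y', hy', e'⟩
    refine ⟨y * (k' + h * y') + k * y', add_mem (mul_mem hy (add_mem (intCast_mem _ _)
      (mul_mem hh hy'))) (mul_mem (intCast_mem _ _) hy'), ?_⟩
    simp only [Prod.mk_mul_mk, Int.cast_mul] at e e' ⊢
    linear_combination x' * e + k * e' + h * y * e'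

section congruenceSubring

variable {R : Type*} [CommRing R] {O : Subring R} {h : R} {hh : h ∈ O}

lemma fst_mem_of_mem_congruenceSubring {x : R} {k : ℤ}
    (hx : (x, k) ∈ congruenceSubring O h hh) : x ∈ O := by
  obtain ⟨y, hy, e⟩ := hx
  rw [show x = h * y + k from sub_eq_iff_eq_add.mp e]
  exact add_mem (mul_mem hh hy) (intCast_mem _ _)

lemma mul_zero_mem_congruenceSubring {r x : R} (hr : r ∈ O)
    (hx : (x, (0 : ℤ)) ∈ congruenceSubring O h hh) :
    (r * x, (0 : ℤ)) ∈ congruenceSubring O h hh := by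
  obtain ⟨y, hy, e⟩ := hx
  refine ⟨r * y, mul_mem hr hy, ?_⟩
  simp only [Int.cast_zero, sub_zero] at e ⊢
  rw [e]; ring

end congruenceSubring

lemma zpow_one_mem {F : Type*} [Field F] {S : Subring (F × ℤ)} {s : F} {p : ℕ} (hp : 0 < p)
    (hs : s ^ p = 1) (hS : (s, (1 : ℤ)) ∈ S) (k : ℤ) : (s ^ k, (1 : ℤ)) ∈ S := by
  have hpow (n : ℕ) : (s ^ n, (1 : ℤ)) ∈ S := by
    simpa only [Prod.pow_mk, one_pow] using pow_mem hS n
  have hinv : s⁻¹ = s ^ (p - 1) := by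
    refine inv_eq_of_mul_eq_one_left ?_
    rw [← pow_succ, Nat.sub_add_cancel hp, hs]
  obtain ⟨n, rfl | rfl⟩ := k.eq_nat_or_neg
  · simpa using hpow n
  · rw [zpow_neg, zpow_natCast, ← inv_pow, hinv, ← pow_mul]
    exact hpow _

lemma qfact_succ {F : Type*} [Field F] (A : F) (n : ℕ) :
    qfact A (n + 1) = qfact A n * qint A ((n : ℤ) + 1) :=
  prod_range_succ _ _

lemma qfact_add {F : Type*} [Field F] (A : F) (n l : ℕ) :
    qfact A (n + l) = qfact A n * ∏ i ∈ range l, qint A (((n + i : ℕ) : ℤ) + 1) :=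
  prod_range_add _ _ _

lemma qfact_ne_zero {F : Type*} [Field F] {A : F} {p k : ℕ} (hA : IsPrimitiveRoot (-A) p)
    (hp : Odd p) (hk : k < p) : qfact A k ≠ 0 := by
  refine prod_ne_zero_iff.mpr fun i hi h => ?_
  have hi' := mem_range.mp hi
  have h0 : -A ≠ 0 := hA.ne_zero (by omega)
  rw [qint, sub_eq_zero, zpow_neg, ← Nat.cast_add_one, zpow_natCast,
    ← mul_eq_one_iff_eq_inv₀ (pow_ne_zero _ h0), ← pow_add, ← two_mul] at h
  have hdvd := hA.dvd_of_pow_eq_one _ h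
  have := Nat.le_of_dvd (by omega) ((Nat.coprime_two_right.mpr hp).dvd_of_dvd_mul_left hdvd)
  omega

lemma qint_add {F : Type*} [Field F] {A : F} (hA : -A ≠ 0) (j k : ℤ) :
    qint A (j + k) = (-A) ^ k * qint A j + (-A) ^ (-j) * qint A k := by
  simp only [qint, neg_add, zpow_add₀ hA]
  ring

/-- Quantum binomial coefficients reduce to ordinary ones. -/
lemma qbinom_mem {F : Type*} [Field F] {A : F} {S : Subring (F × ℤ)} {N : ℕ}
    (hS : ∀ k : ℤ, ((-A) ^ k, (1 : ℤ)) ∈ S) (hA : -A ≠ 0) (hN : ∀ k < N, qfact A k ≠ 0)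
    (j k : ℕ) (hjk : j + k < N) :
    (qfact A (j + k) / (qfact A j * qfact A k), ((j + k).choose j : ℤ)) ∈ S := by
  have h0 : qfact A 0 = 1 := prod_range_zero _
  have hS1 : ((1 : F), (1 : ℤ)) ∈ S := one_mem S
  induction j generalizing k with
  | zero => simp [h0, hN k (by omega), hS1]
  | succ j ihj =>
    induction k with
    | zero => simp [h0, hN (j + 1) hjk, hS1]
    | succ k ihk =>
      have key := add_mem (mul_mem (hS (k + 1)) (ihj (k + 1) (by omega)))
        (mul_mem (hS (-(j + 1))) (ihk (by omega)))
      have hj := hN (j + 1) (by omega)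
      have hk := hN (k + 1) (by omega)
      rw [qfact_succ] at hj hk
      have hj' := mul_ne_zero_iff.mp hj
      have hk' := mul_ne_zero_iff.mp hk
      convert key using 1
      simp only [Prod.mk_mul_mk, Prod.mk_add_mk, one_mul]
      congr 1
      · rw [show j + 1 + (k + 1) = j + k + 1 + 1 by ring, qfact_succ A (j + k + 1),
          show j + (k + 1) = j + k + 1 by ring, show j + 1 + k = j + k + 1 by ring,
          show (((j + k + 1 : ℕ) : ℤ) + 1) = (j + 1) + (k + 1) by push_cast; ring,
          qint_add hA, qfact_succ A j, qfact_succ A k]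
        obtain ⟨a1, a2⟩ := hj'
        obtain ⟨a3, a4⟩ := hk'
        generalize (-A) ^ ((k : ℤ) + 1) = u
        generalize (-A) ^ (-((j : ℤ) + 1)) = v
        field_simp
      · rw [show j + 1 + (k + 1) = (j + k + 1) + 1 by ring, Nat.choose_succ_succ,
          show j + (k + 1) = j + k + 1 by ring, show j + 1 + k = j + k + 1 by ring]
        push_cast; rfl

lemma one_add_mul_geom_sum_sq {F : Type*} [Field F] {t : F} {d : ℕ}
    (ht : IsPrimitiveRoot t (2 * d + 1)) (hd : 0 < d) :
    (1 + t) * ∑ i ∈ range (d + 1), t ^ (2 * i) = 1 := by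
  have h1 : (1 + t) * ∑ i ∈ range (d + 1), t ^ (2 * i) = ∑ i ∈ range (2 * (d + 1)), t ^ i := by
    induction d + 1 with
    | zero => simp
    | succ n ih => rw [sum_range_succ, mul_add, ih, mul_add_one, sum_range_succ, sum_range_succ]; ring
  rw [h1, show 2 * (d + 1) = 2 * d + 1 + 1 by ring, sum_range_succ,
    ht.geom_sum_eq_zero (by omega), ht.pow_eq_one, zero_add]

lemma two_div_one_add_mem {F : Type*} [Field F] {O : Subring F} {h : F} {hh : h ∈ O} {t : F}
    {d : ℕ} (ht : IsPrimitiveRoot t (2 * d + 1)) (hd : 0 < d)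
    (htS : (t, (1 : ℤ)) ∈ congruenceSubring O h hh) :
    (1 + t)⁻¹ ∈ O ∧ (2 * (1 + t)⁻¹, (1 : ℤ)) ∈ congruenceSubring O h hh := by
  have e := one_add_mul_geom_sum_sq ht hd
  have hO : (1 + t)⁻¹ ∈ O := by
    rw [inv_eq_of_mul_eq_one_right e]
    exact sum_mem fun i _ => pow_mem (fst_mem_of_mem_congruenceSubring htS) _
  refine ⟨hO, ?_⟩
  have h0 : 1 + t ≠ 0 := left_ne_zero_of_mul_eq_one e
  have key := add_mem (mul_zero_mem_congruenceSubring hO (x := 1 - t)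
    (sub_mem (one_mem _) htS)) (one_mem (congruenceSubring O h hh))
  convert key using 1
  ext
  · simp only [Prod.fst_add, Prod.fst_one]
    field_simp
    ring
  · simp

lemma gammaCoef_mem {F : Type*} [Field F] {A : F} {O : Subring F} {h : F} {d k : ℕ}
    (hh : h ∈ O) (hA : IsPrimitiveRoot (-A) (2 * d + 1)) (hp : (2 * d + 1).Prime)
    (hS : (-A, (1 : ℤ)) ∈ congruenceSubring O h hh) (hk : k < d) :
    gammaCoef A k ∈ O ∧
      (2 ^ k * gammaCoef A k, (-1 : ℤ) ^ k) ∈ congruenceSubring O h hh := by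
  have hpow (n : ℕ) : ((-A) ^ n, (1 : ℤ)) ∈ congruenceSubring O h hh := by
    simpa only [Prod.pow_mk, one_pow] using pow_mem hS n
  have hfac : gammaCoef A k = (-A) ^ ((k ^ 2 + 5 * k) / 2) *
      ∏ i ∈ Icc 1 k, -(1 + (-A) ^ (2 * i + 1))⁻¹ := by
    rw [gammaCoef, div_eq_mul_inv, ← prod_inv_distrib]
    congr 1
    refine prod_congr rfl fun i _ => ?_
    rw [← inv_neg, (odd_two_mul_add_one i).neg_pow]
    congr 1
    ring
  have hunit (i : ℕ) (hi : i ∈ Icc 1 k) := two_div_one_add_mem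
    (hA.pow_of_coprime (2 * i + 1) (Nat.coprime_of_lt_prime (by omega)
      (by have := mem_Icc.mp hi; omega) hp).symm) (by omega) (hpow (2 * i + 1))
  constructor
  · rw [hfac]
    exact mul_mem (fst_mem_of_mem_congruenceSubring (hpow _))
      (prod_mem fun i hi => neg_mem (hunit i hi).1)
  · have key := mul_mem (hpow ((k ^ 2 + 5 * k) / 2))
      (prod_mem fun i hi => neg_mem (hunit i hi).2)
    convert key using 1
    ext
    · simp only [Prod.fst_mul, Prod.fst_prod, Prod.fst_neg, hfac, ← mul_neg, prod_mul_distrib,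
        prod_const, Nat.card_Icc, Nat.add_sub_cancel]
      ring
    · simp [Prod.snd_prod]

lemma bCoef_eq {F : Type*} [Field F] {A : F} {N c m r : ℕ} (hN : ∀ k < N, qfact A k ≠ 0)
    (h : r + 2 * m + 2 * c + 1 < N) :
    bCoef A c (m + r) m = ∑ l ∈ range (m + c + 1),
      (qfact A (m + r) / (qfact A m * qfact A r)) *
        ((-1) ^ l * (qfact A (m + c) / (qfact A l * qfact A (m + c - l))) *
          gammaCoef A (l + r)) *
        ∏ i ∈ range l, qint A (((m + r + c + 1 + i : ℕ) : ℤ) + 1) := by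
  refine sum_congr rfl fun l hl => ?_
  have hl' := mem_range.mp hl
  have h1 := hN (l + r) (by omega)
  have h2 := hN (m + r + c + 1) (by omega)
  have h3 := hN r (by omega)
  have h4 := hN m (by omega)
  have h5 := hN l (by omega)
  have h6 := hN (m + c - l) (by omega)
  rw [Ccoef, show l + (m + r) - m = l + r by omega, show l + r - l = r by omega,
    show l + r + (m + c) + 1 - l = m + r + c + 1 by omega,
    show l + r + (m + c) + 1 = m + r + c + 1 + l by omega, qfact_add A (m + r + c + 1)]
  field_simp

/-- Lemma 5.5 for `t*`: `b^{(c)}_{n,m}` lies in `O = ℤ[ζ]` and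
`2^{n-m}·b^{(c)}_{n,m} - (-1)^{n-m}·C(n,m) ∈ (1-ζ)·O`. -/
theorem stmt15 (p : ℕ) (hp : p.Prime) (hp5 : 5 ≤ p) (ζ : ℂ)
    (hζ : IsPrimitiveRoot ζ p) (A : ℂ) (hA : A = -ζ ^ ((p - 1) / 2 + 1))
    (c m n : ℕ) (hc : c ≤ (p - 1) / 2 - 1) (hmn : m ≤ n)
    (hn : n ≤ (p - 1) / 2 - c - 1) :
    bCoef A c n m ∈ Oring ζ ∧
    ∃ x : Oring ζ,
      (2 : ℂ) ^ (n - m) * bCoef A c n m -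
          (-1 : ℂ) ^ (n - m) * ((Nat.choose n m : ℕ) : ℂ) = (1 - ζ) * (x : ℂ) := by
  obtain ⟨d, hd⟩ : ∃ d, p = 2 * d + 1 := hp.odd_of_ne_two (by omega)
  have hd' : (p - 1) / 2 = d := by omega
  rw [hd'] at hA hc hn
  have hs : -A = ζ ^ (d + 1) := by rw [hA, neg_neg]
  have hprim : IsPrimitiveRoot (-A) p := by
    rw [hs]
    exact hζ.pow_of_coprime _ (Nat.coprime_of_lt_prime (by omega) (by omega) hp).symm
  have hζO : ζ ∈ Oring ζ := Subring.subset_closure rfl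
  have hhO : 1 - ζ ∈ Oring ζ := sub_mem (one_mem _) hζO
  set S := congruenceSubring (Oring ζ) (1 - ζ) hhO
  have hζS : (ζ, (1 : ℤ)) ∈ S := ⟨-1, neg_mem (one_mem _), by push_cast; ring⟩
  have hsS : (-A, (1 : ℤ)) ∈ S := by
    have := pow_mem hζS (d + 1)
    rwa [Prod.pow_mk, one_pow, ← hs] at this
  have hzS := zpow_one_mem (hp.pos) hprim.pow_eq_one hsS
  have hq : ∀ k : ℤ, (qint A k, (0 : ℤ)) ∈ S := fun k => by
    simpa [qint] using sub_mem (hzS k) (hzS (-k))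
  have hne : ∀ k : ℕ, k < p → qfact A k ≠ 0 := fun k hk =>
    qfact_ne_zero hprim (hp.odd_of_ne_two (by omega)) hk
  have hB := fun j k (hjk : j + k < p) => qbinom_mem (S := S) hzS (hprim.ne_zero hp.ne_zero) hne j k hjk
  have hγ := fun k (hk : k < d) => gammaCoef_mem (k := k) hhO (hd ▸ hprim) (hd ▸ hp) hsS hk
  obtain ⟨r, rfl⟩ := Nat.exists_eq_add_of_le hmn
  rw [bCoef_eq (A := A) hne (by omega), Nat.add_sub_cancel_left]
  have hcoef : ∀ l ∈ range (m + c + 1), (-1) ^ l * (qfact A (m + c) /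
      (qfact A l * qfact A (m + c - l))) * gammaCoef A (l + r) ∈ Oring ζ := fun l hl => by
    have hl' := mem_range.mp hl
    have hBl := hB l (m + c - l) (by omega)
    rw [show l + (m + c - l) = m + c by omega] at hBl
    exact mul_mem (mul_mem (pow_mem (neg_mem (one_mem _)) _)
      (fst_mem_of_mem_congruenceSubring hBl)) (hγ (l + r) (by omega)).1
  have hBr := hB m r (by omega)
  have hBO := fst_mem_of_mem_congruenceSubring hBr
  refine ⟨sum_mem fun l hl => mul_mem (mul_mem hBO (hcoef l hl))
    (prod_mem fun i _ => fst_mem_of_mem_congruenceSubring (hq _)), ?_⟩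
  have h2 : (2 : ℂ) ∈ Oring ζ := ofNat_mem _ 2
  have htail := sum_mem (S := S) fun l (hl : l ∈ range (m + c)) =>
    mul_zero_mem_congruenceSubring (mul_mem (pow_mem h2 r)
      (mul_mem hBO (hcoef (l + 1) (by simpa using hl))))
      (mul_zero_mem_congruenceSubring (prod_mem fun i (_ : i ∈ range l) =>
        fst_mem_of_mem_congruenceSubring (hq (((m + r + c + 1 + i : ℕ) : ℤ) + 1)))
        (hq (((m + r + c + 1 + l : ℕ) : ℤ) + 1)))
  obtain ⟨y, hy, e⟩ := add_mem htail (mul_mem hBr (hγ r (by omega)).2)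
  refine ⟨⟨y, hy⟩, ?_⟩
  rw [← e, sum_range_succ', mul_add, mul_sum]
  have hc0 : qfact A (m + c) ≠ 0 := hne _ (by omega)
  have h0 : qfact A 0 = 1 := prod_range_zero _
  simp only [Prod.fst_add, Prod.snd_add, Prod.fst_sum, Prod.snd_sum, Prod.mk_mul_mk,
    prod_range_succ, sum_const_zero, zero_add, h0, prod_range_zero, Nat.sub_zero, pow_zero,
    one_mul, div_self hc0, mul_one]
  push_cast
  simp only [mul_assoc]
  ring
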